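/- For each ν > -1, the function q_ν(x) = I_ν(x) K_ν(x) / (1 + |ln x|) is decreasing on [1, ∞). -/

import Mathlib

open Real MeasureTheory Set Filter

/-- Modified Bessel function of the first kind `I_ν`. -/
noncomputable def besselI (ν x : ℝ) : ℝ :=
  ∑' n : ℕ, (x / 2) ^ (2 * (n : ℝ) + ν) / ((n.factorial : ℝ) * Real.Gamma ((n : ℝ) + ν + 1))

/-- Modified Bessel function of the second kind `K_ν`. -/
noncomputable def besselK (ν x : ℝ) : ℝ :=
  ∫ t in Ioi (0 : ℝ), Real.exp (-x * Real.cosh t) * Real.cosh (ν * t)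

/-- Bessel function of the first kind `J_ν`. -/
noncomputable def besselJ (ν x : ℝ) : ℝ :=
  ∑' n : ℕ, (-1 : ℝ) ^ n * (x / 2) ^ (2 * (n : ℝ) + ν) /
    ((n.factorial : ℝ) * Real.Gamma ((n : ℝ) + ν + 1))

/-- Modified Struve function of the first kind `L_ν`. -/
noncomputable def struveL (ν x : ℝ) : ℝ :=
  ∑' n : ℕ, (x / 2) ^ (2 * (n : ℝ) + ν + 1) /
    (Real.Gamma ((n : ℝ) + 3 / 2) * Real.Gamma ((n : ℝ) + ν + 3 / 2))

/-- Airy function `Ai`. -/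
noncomputable def airyAi (t : ℝ) : ℝ :=
  (1 / Real.pi) * ∫ s in Ioi (0 : ℝ), Real.cos (s ^ 3 / 3 + s * t)

/-- Landau constant `b_L = 2^{1/3} ⬝ sup_{t ≥ 0} Ai(t)`. -/
noncomputable def landau_bL : ℝ :=
  (2 : ℝ) ^ ((1 : ℝ) / 3) * sSup (airyAi '' Ici 0)

/-- Landau constant `c_L = sup_{t ≥ 0} t^{1/3} J₀(t)`. -/
noncomputable def landau_cL : ℝ :=
  sSup ((fun t : ℝ => t ^ ((1 : ℝ) / 3) * besselJ 0 t) '' Ici 0)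

section BesselI

/-- The entire function `f` with `I_ν(x) = (x / 2) ^ ν * f ((x / 2) ^ 2)` has these coefficients. -/
noncomputable def besselICoeff (ν : ℝ) (n : ℕ) : ℝ :=
  ((n.factorial : ℝ) * Real.Gamma ((n : ℝ) + ν + 1))⁻¹

lemma besselICoeff_pos {ν : ℝ} (hν : -1 < ν) (n : ℕ) : 0 < besselICoeff ν n := by
  have : 0 < Real.Gamma ((n : ℝ) + ν + 1) :=
    Real.Gamma_pos_of_pos (by linarith [n.cast_nonneg (α := ℝ)])
  unfold besselICoeff
  positivity

lemma besselICoeff_succ {ν : ℝ} (hν : -1 < ν) (n : ℕ) :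
    ((n : ℝ) + 1) * ((n : ℝ) + 1 + ν) * besselICoeff ν (n + 1) = besselICoeff ν n := by
  have h : 0 < (n : ℝ) + ν + 1 := by linarith [n.cast_nonneg (α := ℝ)]
  have hG := Real.Gamma_pos_of_pos h
  have e : ((n + 1 : ℕ) : ℝ) + ν + 1 = ((n : ℝ) + ν + 1) + 1 := by push_cast; ring
  unfold besselICoeff
  rw [e, Real.Gamma_add_one h.ne', Nat.factorial_succ]
  push_cast
  field_simp
  ring

lemma exists_besselICoeff_le {ν : ℝ} (hν : -1 < ν) :
    ∃ C, 0 ≤ C ∧ ∀ n, besselICoeff ν n ≤ C / (n.factorial : ℝ) := by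
  have h0 : 0 < Real.Gamma (ν + 1) := Real.Gamma_pos_of_pos (by linarith)
  have h1 : 0 < Real.Gamma (ν + 2) := Real.Gamma_pos_of_pos (by linarith)
  set m := min (Real.Gamma (ν + 1)) (Real.Gamma (ν + 2)) with hm
  have hm0 : 0 < m := lt_min h0 h1
  have key : ∀ n : ℕ, m ≤ Real.Gamma (((n + 1 : ℕ) : ℝ) + ν + 1) := by
    intro n
    induction n with
    | zero =>
      refine (min_le_right _ _).trans_eq ?_
      congr 1
      push_cast
      ring
    | succ n ih =>
      have hp : 1 ≤ ((n + 1 : ℕ) : ℝ) + ν + 1 := by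
        push_cast; linarith [n.cast_nonneg (α := ℝ)]
      have e : ((n + 1 + 1 : ℕ) : ℝ) + ν + 1 = (((n + 1 : ℕ) : ℝ) + ν + 1) + 1 := by
        push_cast; ring
      rw [e, Real.Gamma_add_one (by linarith)]
      nlinarith
  refine ⟨m⁻¹, by positivity, fun n => ?_⟩
  have hn : m ≤ Real.Gamma ((n : ℝ) + ν + 1) := by
    cases n with
    | zero => simp [hm]
    | succ n => exact key n
  have hf : (0 : ℝ) < n.factorial := by positivity
  unfold besselICoeff
  rw [div_eq_mul_inv, ← mul_inv, mul_comm]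
  gcongr

lemma summable_pow_mul_besselICoeff {ν : ℝ} (hν : -1 < ν) (k : ℕ) {z : ℝ} (hz : 0 ≤ z) :
    Summable fun n : ℕ => (n : ℝ) ^ k * (besselICoeff ν n * z ^ n) := by
  obtain ⟨C, hC, h⟩ := exists_besselICoeff_le hν
  refine Summable.of_nonneg_of_le (fun n => ?_) (fun n => ?_)
    ((Real.summable_pow_div_factorial (2 ^ k * z)).mul_left C)
  · have := (besselICoeff_pos hν n).le
    positivity
  · have h2 : (n : ℝ) ≤ 2 ^ n := by exact_mod_cast n.lt_two_pow_self.le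
    calc (n : ℝ) ^ k * (besselICoeff ν n * z ^ n)
        ≤ ((2 : ℝ) ^ n) ^ k * (C / (n.factorial : ℝ) * z ^ n) := by
          have := (besselICoeff_pos hν n).le
          gcongr
          exact h n
      _ = C * ((2 ^ k * z) ^ n / (n.factorial : ℝ)) := by
          rw [mul_pow, ← pow_mul, ← pow_mul, mul_comm n k]
          ring

/-- The weighted sums `∑ n ^ k c_n z ^ n` attached to the series of `I_ν`. -/
noncomputable def besselISum (ν : ℝ) (k : ℕ) (z : ℝ) : ℝ :=
  ∑' n : ℕ, (n : ℝ) ^ k * (besselICoeff ν n * z ^ n)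

lemma besselISum_zero_nonneg {ν : ℝ} (hν : -1 < ν) {z : ℝ} (hz : 0 ≤ z) :
    0 ≤ besselISum ν 0 z :=
  tsum_nonneg fun n => by
    have := (besselICoeff_pos hν n).le
    positivity

lemma besselISum_zero_pos {ν : ℝ} (hν : -1 < ν) {z : ℝ} (hz : 0 ≤ z) :
    0 < besselISum ν 0 z :=
  (summable_pow_mul_besselICoeff hν 0 hz).tsum_pos
    (fun n => by
      have := (besselICoeff_pos hν n).le
      positivity) 0 (by simpa using besselICoeff_pos hν 0)

lemma besselISum_ode {ν : ℝ} (hν : -1 < ν) {z : ℝ} (hz : 0 ≤ z) :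
    besselISum ν 2 z + ν * besselISum ν 1 z = z * besselISum ν 0 z := by
  have s2 := summable_pow_mul_besselICoeff hν 2 hz
  have s1 := summable_pow_mul_besselICoeff hν 1 hz
  unfold besselISum
  rw [← tsum_mul_left, ← tsum_mul_left, ← s2.tsum_add (s1.mul_left ν),
    (s2.add (s1.mul_left ν)).tsum_eq_zero_add]
  simp only [Nat.cast_zero, ne_eq, OfNat.ofNat_ne_zero, not_false_eq_true, zero_pow, zero_mul,
    one_ne_zero, mul_zero, add_zero, zero_add]
  refine tsum_congr fun n => ?_
  rw [← besselICoeff_succ hν n]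
  push_cast
  ring

lemma sq_besselISum_le {ν : ℝ} (hν : -1 < ν) {z : ℝ} (hz : 0 ≤ z) :
    (2 * besselISum ν 1 z + ν * besselISum ν 0 z) ^ 2 ≤ (4 * z + ν ^ 2) * besselISum ν 0 z ^ 2 := by
  have hpos := besselISum_zero_pos hν hz
  have s2 := summable_pow_mul_besselICoeff hν 2 hz
  have s1 := summable_pow_mul_besselICoeff hν 1 hz
  have s0 := summable_pow_mul_besselICoeff hν 0 hz
  have hode := besselISum_ode hν hz
  have quad : ∀ l : ℝ, 0 ≤ 4 * besselISum ν 2 z + 4 * l * besselISum ν 1 z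
      + l ^ 2 * besselISum ν 0 z := by
    intro l
    have hs := ((s2.hasSum.mul_left 4).add (s1.hasSum.mul_left (4 * l))).add
      (s0.hasSum.mul_left (l ^ 2))
    refine hs.nonneg fun n => ?_
    have := (besselICoeff_pos hν n).le
    have e : 4 * ((n : ℝ) ^ 2 * (besselICoeff ν n * z ^ n))
        + 4 * l * ((n : ℝ) ^ 1 * (besselICoeff ν n * z ^ n))
        + l ^ 2 * ((n : ℝ) ^ 0 * (besselICoeff ν n * z ^ n))
        = (2 * n + l) ^ 2 * (besselICoeff ν n * z ^ n) := by ring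
    rw [e]
    positivity
  have h := quad (-2 * besselISum ν 1 z / besselISum ν 0 z)
  set A := besselISum ν 0 z
  set B := besselISum ν 1 z
  have h2 : B ^ 2 ≤ besselISum ν 2 z * A := by
    have := mul_nonneg h hpos.le
    field_simp at this
    nlinarith
  nlinarith

lemma hasDerivAt_besselISum_zero {ν : ℝ} (hν : -1 < ν) {z : ℝ} (hz : 0 < z) :
    HasDerivAt (besselISum ν 0) (besselISum ν 1 z / z) z := by
  have hu : Summable fun n : ℕ => (n : ℝ) * besselICoeff ν n * (2 * z) ^ (n - 1) := by
    refine ((summable_pow_mul_besselICoeff hν 1 (z := 2 * z) (by positivity)).mul_left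
      (2 * z)⁻¹).congr fun n => ?_
    cases n with
    | zero => simp
    | succ n =>
      simp only [add_tsub_cancel_right, pow_succ]
      field_simp
  have h := hasDerivAt_tsum_of_isPreconnected (𝕜 := ℝ) (F := ℝ) (t := Ioo 0 (2 * z))
    (g := fun (n : ℕ) y => (n : ℝ) ^ 0 * (besselICoeff ν n * y ^ n))
    (g' := fun (n : ℕ) y => (n : ℝ) * besselICoeff ν n * y ^ (n - 1)) (y₀ := z) (y := z)
    hu isOpen_Ioo isPreconnected_Ioo
    (fun n y _ => by
      have := ((hasDerivAt_pow n y).const_mul (besselICoeff ν n)).const_mul ((n : ℝ) ^ 0)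
      refine this.congr_deriv ?_
      ring)
    (fun n y hy => by
      have := (besselICoeff_pos hν n).le
      have := hy.1.le
      rw [Real.norm_of_nonneg (by positivity)]
      gcongr
      exact hy.2.le)
    ⟨hz, by linarith⟩ (summable_pow_mul_besselICoeff hν 0 hz.le) ⟨hz, by linarith⟩
  refine h.congr_deriv ?_
  unfold besselISum
  rw [← tsum_div_const]
  refine tsum_congr fun n => ?_
  cases n with
  | zero => simp
  | succ n =>
    simp only [add_tsub_cancel_right, pow_succ]
    field_simp

lemma besselI_eq {ν x : ℝ} (hx : 0 < x) :
    besselI ν x = (x / 2) ^ ν * besselISum ν 0 ((x / 2) ^ 2) := by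
  unfold besselI besselISum besselICoeff
  rw [← tsum_mul_left]
  refine tsum_congr fun n => ?_
  have : (x / 2) ^ (2 * (n : ℝ) + ν) = (x / 2) ^ ν * ((x / 2) ^ 2) ^ n := by
    rw [Real.rpow_add (by positivity), ← pow_mul, ← Real.rpow_natCast (x / 2) (2 * n)]
    push_cast
    ring
  rw [this]
  ring

lemma besselI_nonneg {ν : ℝ} (hν : -1 < ν) {x : ℝ} (hx : 0 < x) : 0 ≤ besselI ν x := by
  rw [besselI_eq hx]
  have := besselISum_zero_nonneg hν (sq_nonneg (x / 2))
  positivity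

lemma exists_hasDerivAt_besselI {ν : ℝ} (hν : -1 < ν) {x : ℝ} (hx : 0 < x) :
    ∃ I', HasDerivAt (besselI ν) I' x ∧ x * I' ≤ √(x ^ 2 + ν ^ 2) * besselI ν x := by
  have hz : 0 < (x / 2) ^ 2 := by positivity
  have hlin : HasDerivAt (fun y : ℝ => y / 2) (1 / 2) x := (hasDerivAt_id x).div_const 2
  have hcomp := (hasDerivAt_besselISum_zero hν hz).comp x (hlin.pow 2)
  have hpow := hlin.rpow_const (p := ν) (Or.inl (by positivity))
  refine ⟨_, (hpow.mul hcomp).congr_of_eventuallyEq ?_, ?_⟩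
  · filter_upwards [lt_mem_nhds hx] with y hy
    simp [besselI_eq hy]
  · have hle := Real.abs_le_sqrt (sq_besselISum_le hν hz.le)
    have hA := besselISum_zero_nonneg hν hz.le
    have e : 4 * (x / 2) ^ 2 + ν ^ 2 = x ^ 2 + ν ^ 2 := by ring
    rw [Real.sqrt_mul (by positivity), Real.sqrt_sq hA, e] at hle
    rw [besselI_eq hx, Real.rpow_sub_one (by positivity)]
    have hr : 0 ≤ (x / 2) ^ ν := by positivity
    have := mul_le_mul_of_nonneg_left ((le_abs_self _).trans hle) hr
    refine le_of_eq_of_le ?_ (this.trans_eq (by ring))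
    simp only [Function.comp_apply, Pi.pow_apply]
    field_simp
    ring

end BesselI

section BesselK

lemma exists_exp_neg_mul_cosh_mul_exp_le {x : ℝ} (hx : 0 < x) (c : ℝ) :
    ∃ C, 0 ≤ C ∧ ∀ t, 0 ≤ t → Real.exp (-x * Real.cosh t) * Real.exp (c * t) ≤ C * Real.exp (-t) := by
  refine ⟨Real.exp ((c + 1) ^ 2 / x), (Real.exp_pos _).le, fun t ht => ?_⟩
  rw [← Real.exp_add, ← Real.exp_add, Real.exp_le_exp]
  have h1 : t ^ 2 / 4 ≤ Real.cosh t := by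
    rw [Real.cosh_eq]
    linarith [Real.quadratic_le_exp_of_nonneg ht, Real.exp_pos (-t)]
  have h2 : (c + 1) * t ≤ x * (t ^ 2 / 4) + (c + 1) ^ 2 / x := by
    have e : x * (t ^ 2 / 4) + (c + 1) ^ 2 / x - (c + 1) * t = (x * t / 2 - (c + 1)) ^ 2 / x := by
      field_simp
      ring
    have : 0 ≤ (x * t / 2 - (c + 1)) ^ 2 / x := by positivity
    linarith
  nlinarith

lemma cosh_le_exp_of_nonneg {t : ℝ} (ht : 0 ≤ t) : Real.cosh t ≤ Real.exp t := by
  rw [Real.cosh_eq]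
  have : Real.exp (-t) ≤ Real.exp t := Real.exp_le_exp.2 (by linarith)
  linarith

lemma cosh_mul_le_exp (ν : ℝ) {t : ℝ} (ht : 0 ≤ t) : Real.cosh (ν * t) ≤ Real.exp (|ν| * t) := by
  rw [← Real.cosh_abs, abs_mul, abs_of_nonneg ht]
  exact cosh_le_exp_of_nonneg (by positivity)

lemma abs_sinh_le_cosh (t : ℝ) : |Real.sinh t| ≤ Real.cosh t := by
  rw [Real.abs_sinh, ← Real.cosh_abs]
  exact (Real.sinh_lt_cosh _).le

/-- The integrand of the `j`-th derivative of `K_ν`, up to sign. -/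
noncomputable def besselKIntegrand (ν : ℝ) (j : ℕ) (x t : ℝ) : ℝ :=
  Real.exp (-x * Real.cosh t) * Real.cosh t ^ j * Real.cosh (ν * t)

/-- The `j`-th derivative of `K_ν`, up to sign. -/
noncomputable def besselKMoment (ν : ℝ) (j : ℕ) (x : ℝ) : ℝ :=
  ∫ t in Ioi (0 : ℝ), besselKIntegrand ν j x t

lemma besselKIntegrand_nonneg (ν : ℝ) (j : ℕ) (x t : ℝ) : 0 ≤ besselKIntegrand ν j x t := by
  have := Real.cosh_pos t
  have := Real.cosh_pos (ν * t)
  unfold besselKIntegrand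
  positivity

lemma continuous_besselKIntegrand (ν : ℝ) (j : ℕ) (x : ℝ) :
    Continuous (besselKIntegrand ν j x) := by
  unfold besselKIntegrand
  fun_prop

lemma besselKIntegrand_anti (ν : ℝ) (j : ℕ) {x y : ℝ} (h : x ≤ y) (t : ℝ) :
    besselKIntegrand ν j y t ≤ Real.exp (-(y - x)) * besselKIntegrand ν j x t := by
  have := Real.cosh_pos t
  have := Real.cosh_pos (ν * t)
  unfold besselKIntegrand
  rw [← mul_assoc, ← mul_assoc, ← Real.exp_add]
  gcongr
  nlinarith [Real.one_le_cosh t]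

lemma exists_besselKIntegrand_le (ν : ℝ) (j : ℕ) {x : ℝ} (hx : 0 < x) :
    ∃ C, 0 ≤ C ∧ ∀ t, 0 ≤ t → besselKIntegrand ν j x t ≤ C * Real.exp (-t) := by
  obtain ⟨C, hC, h⟩ := exists_exp_neg_mul_cosh_mul_exp_le hx (j + |ν|)
  refine ⟨C, hC, fun t ht => le_trans ?_ (h t ht)⟩
  have h1 := Real.cosh_pos t
  have h2 := Real.cosh_pos (ν * t)
  unfold besselKIntegrand
  rw [add_mul, Real.exp_add, Real.exp_nat_mul, ← mul_assoc]
  gcongr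
  · exact cosh_le_exp_of_nonneg ht
  · exact cosh_mul_le_exp ν ht

lemma integrableOn_besselKIntegrand (ν : ℝ) (j : ℕ) {x : ℝ} (hx : 0 < x) :
    IntegrableOn (besselKIntegrand ν j x) (Ioi 0) := by
  obtain ⟨C, -, h⟩ := exists_besselKIntegrand_le ν j hx
  refine Integrable.mono' ((integrableOn_exp_neg_Ioi 0).const_mul C)
    (continuous_besselKIntegrand ν j x).aestronglyMeasurable ?_
  filter_upwards [ae_restrict_mem measurableSet_Ioi] with t ht
  rw [Real.norm_of_nonneg (besselKIntegrand_nonneg _ _ _ _)]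
  exact h t (le_of_lt ht)

lemma besselK_eq (ν : ℝ) : besselK ν = besselKMoment ν 0 := by
  ext x
  simp [besselK, besselKMoment, besselKIntegrand]

lemma besselKMoment_nonneg (ν : ℝ) (j : ℕ) (x : ℝ) : 0 ≤ besselKMoment ν j x :=
  integral_nonneg fun t => besselKIntegrand_nonneg ν j x t

lemma besselKMoment_anti (ν : ℝ) (j : ℕ) {x y : ℝ} (hx : 0 < x) (h : x ≤ y) :
    besselKMoment ν j y ≤ Real.exp (-(y - x)) * besselKMoment ν j x := by
  unfold besselKMoment
  rw [← integral_const_mul]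
  exact integral_mono (integrableOn_besselKIntegrand ν j (hx.trans_le h))
    ((integrableOn_besselKIntegrand ν j hx).const_mul _) fun t => besselKIntegrand_anti ν j h t

lemma tendsto_pow_mul_besselKMoment (ν : ℝ) (j k : ℕ) :
    Tendsto (fun x => x ^ k * besselKMoment ν j x) atTop (nhds 0) := by
  have h := (Real.tendsto_pow_mul_exp_neg_atTop_nhds_zero k).mul_const
    (Real.exp 1 * besselKMoment ν j 1)
  rw [zero_mul] at h
  refine squeeze_zero' ?_ ?_ h
  · filter_upwards [eventually_ge_atTop 0] with x hx
    have := besselKMoment_nonneg ν j x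
    positivity
  · filter_upwards [eventually_ge_atTop 1] with x hx
    have h1 := besselKMoment_anti ν j one_pos hx
    have e : Real.exp (-(x - 1)) = Real.exp (-x) * Real.exp 1 := by
      rw [← Real.exp_add]
      ring_nf
    rw [e] at h1
    calc x ^ k * besselKMoment ν j x
        ≤ x ^ k * (Real.exp (-x) * Real.exp 1 * besselKMoment ν j 1) := by gcongr
      _ = _ := by ring

lemma hasDerivAt_besselKMoment (ν : ℝ) (j : ℕ) {x : ℝ} (hx : 0 < x) :
    HasDerivAt (besselKMoment ν j) (-besselKMoment ν (j + 1) x) x := by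
  have h := hasDerivAt_integral_of_dominated_loc_of_deriv_le (𝕜 := ℝ)
    (μ := volume.restrict (Ioi (0 : ℝ))) (F := besselKIntegrand ν j)
    (F' := fun y t => -besselKIntegrand ν (j + 1) y t)
    (bound := besselKIntegrand ν (j + 1) (x / 2)) (s := Ioi (x / 2)) (x₀ := x)
    (Ioi_mem_nhds (by linarith))
    (Eventually.of_forall fun y => (continuous_besselKIntegrand ν j y).aestronglyMeasurable)
    (integrableOn_besselKIntegrand ν j hx)
    (continuous_besselKIntegrand ν (j + 1) x).neg.aestronglyMeasurable
    (Eventually.of_forall fun t y hy => by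
      rw [norm_neg, Real.norm_of_nonneg (besselKIntegrand_nonneg _ _ _ _)]
      refine (besselKIntegrand_anti ν (j + 1) (le_of_lt hy) t).trans
        (mul_le_of_le_one_left (besselKIntegrand_nonneg _ _ _ _) ?_)
      rw [Real.exp_le_one_iff]
      linarith [mem_Ioi.1 hy])
    (integrableOn_besselKIntegrand ν (j + 1) (by positivity))
    (Eventually.of_forall fun t y _ => by
      have h1 : HasDerivAt (fun y : ℝ => -y * Real.cosh t) (-1 * Real.cosh t) y :=
        (hasDerivAt_id y).neg.mul_const _
      have h2 := (h1.exp.mul_const (Real.cosh t ^ j)).mul_const (Real.cosh (ν * t))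
      refine h2.congr_deriv ?_
      unfold besselKIntegrand
      ring)
  have h2 := h.2
  rw [integral_neg] at h2
  exact h2

lemma besselKMoment_ode (ν : ℝ) {x : ℝ} (hx : 0 < x) :
    x ^ 2 * besselKMoment ν 2 x
      = (x ^ 2 + ν ^ 2) * besselKMoment ν 0 x + x * besselKMoment ν 1 x := by
  have i0 := integrableOn_besselKIntegrand ν 0 hx
  have i1 := integrableOn_besselKIntegrand ν 1 hx
  have i2 := integrableOn_besselKIntegrand ν 2 hx
  set Φ : ℝ → ℝ := fun t => Real.exp (-x * Real.cosh t) *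
    (x * Real.sinh t * Real.cosh (ν * t) + ν * Real.sinh (ν * t)) with hΦ
  have hd : ∀ t, HasDerivAt Φ ((x ^ 2 + ν ^ 2) * besselKIntegrand ν 0 x t
      + x * besselKIntegrand ν 1 x t - x ^ 2 * besselKIntegrand ν 2 x t) t := by
    intro t
    have hl : HasDerivAt (fun t : ℝ => ν * t) ν t := by
      simpa using (hasDerivAt_id t).const_mul ν
    have h1 := ((Real.hasDerivAt_cosh t).const_mul (-x)).exp
    have h2 := (((Real.hasDerivAt_sinh t).const_mul x).mul hl.cosh).add (hl.sinh.const_mul ν)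
    refine (h1.mul h2).congr_deriv ?_
    have hs : Real.cosh t ^ 2 = Real.sinh t ^ 2 + 1 := Real.cosh_sq t
    simp only [besselKIntegrand, hs, Pi.add_apply, Pi.mul_apply]
    ring
  have hlim : Tendsto Φ atTop (nhds 0) := by
    obtain ⟨C1, -, h1⟩ := exists_besselKIntegrand_le ν 1 hx
    obtain ⟨C0, -, h0⟩ := exists_besselKIntegrand_le ν 0 hx
    have hb : Tendsto (fun t => (x * C1 + |ν| * C0) * Real.exp (-t)) atTop (nhds 0) := by
      simpa using Real.tendsto_exp_neg_atTop_nhds_zero.const_mul (x * C1 + |ν| * C0)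
    refine squeeze_zero_norm' ?_ hb
    filter_upwards [eventually_ge_atTop 0] with t ht
    have hc := Real.cosh_pos (ν * t)
    calc ‖Φ t‖ ≤ Real.exp (-x * Real.cosh t) *
          (x * Real.cosh t * Real.cosh (ν * t) + |ν| * Real.cosh (ν * t)) := by
          rw [hΦ, norm_mul, Real.norm_of_nonneg (Real.exp_pos _).le, Real.norm_eq_abs]
          gcongr
          refine (abs_add_le _ _).trans ?_
          rw [abs_mul, abs_mul, abs_mul, abs_of_pos hx, abs_of_pos hc]
          gcongr
          · exact abs_sinh_le_cosh t
          · exact abs_sinh_le_cosh _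
      _ = x * besselKIntegrand ν 1 x t + |ν| * besselKIntegrand ν 0 x t := by
          unfold besselKIntegrand
          ring
      _ ≤ x * (C1 * Real.exp (-t)) + |ν| * (C0 * Real.exp (-t)) := by
          gcongr
          · exact h1 t ht
          · exact h0 t ht
      _ = _ := by ring
  have h := integral_Ioi_of_hasDerivAt_of_tendsto (a := 0)
    (hd 0).continuousAt.continuousWithinAt (fun t _ => hd t)
    (((i0.const_mul _).add (i1.const_mul _)).sub (i2.const_mul _)) hlim
  have i01 : IntegrableOn (fun t => (x ^ 2 + ν ^ 2) * besselKIntegrand ν 0 x t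
      + x * besselKIntegrand ν 1 x t) (Ioi 0) := (i0.const_mul _).add (i1.const_mul _)
  rw [integral_sub i01 (i2.const_mul _), integral_add (i0.const_mul _) (i1.const_mul _), integral_const_mul, integral_const_mul,
    integral_const_mul] at h
  have hΦ0 : Φ 0 = 0 := by simp [hΦ]
  rw [hΦ0] at h
  unfold besselKMoment
  linarith

lemma sq_besselKMoment_le (ν : ℝ) {x : ℝ} (hx : 0 < x) :
    (x ^ 2 + ν ^ 2) * besselKMoment ν 0 x ^ 2 ≤ (x * besselKMoment ν 1 x) ^ 2 := by
  set F : ℝ → ℝ := fun y =>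
    (y * besselKMoment ν 1 y) ^ 2 - (y ^ 2 + ν ^ 2) * besselKMoment ν 0 y ^ 2 with hF
  have hd : ∀ y, 0 < y → HasDerivAt F (-2 * y * besselKMoment ν 0 y ^ 2) y := by
    intro y hy
    have h1 := ((hasDerivAt_id y).mul (hasDerivAt_besselKMoment ν 1 hy)).pow 2
    have h2 := (((hasDerivAt_id y).pow 2).add_const (ν ^ 2)).mul
      ((hasDerivAt_besselKMoment ν 0 hy).pow 2)
    refine (h1.sub h2).congr_deriv ?_
    simp only [Pi.mul_apply, Pi.pow_apply, id_eq, Nat.reduceAdd, Nat.add_one_sub_one, zero_add,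
      Nat.cast_ofNat, pow_one, mul_one, one_mul]
    linear_combination -2 * besselKMoment ν 1 y * besselKMoment_ode ν hy
  have hanti : AntitoneOn F (Ioi 0) := by
    refine antitoneOn_of_deriv_nonpos (convex_Ioi 0)
      (fun y hy => (hd y hy).continuousAt.continuousWithinAt) ?_ ?_
    · rw [interior_Ioi]
      exact fun y hy => (hd y hy).differentiableAt.differentiableWithinAt
    · rw [interior_Ioi]
      intro y hy
      rw [(hd y hy).deriv]
      have : 0 < y := hy
      have : 0 ≤ y * besselKMoment ν 0 y ^ 2 := by positivity
      linarith
  have hlim : Tendsto F atTop (nhds 0) := by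
    have h := (((tendsto_pow_mul_besselKMoment ν 1 1).pow 2).sub
      ((tendsto_pow_mul_besselKMoment ν 0 1).pow 2)).sub
      (((tendsto_pow_mul_besselKMoment ν 0 0).pow 2).const_mul (ν ^ 2))
    refine (h.congr fun y => ?_).trans (by simp)
    simp only [hF]
    ring
  have : 0 ≤ F x := le_of_tendsto hlim (by
    filter_upwards [eventually_ge_atTop x] with y hy
    exact hanti hx (hx.trans_le hy) hy)
  simp only [hF] at this
  linarith

lemma exists_hasDerivAt_besselK (ν : ℝ) {x : ℝ} (hx : 0 < x) :
    ∃ K', HasDerivAt (besselK ν) K' x ∧ x * K' ≤ -(√(x ^ 2 + ν ^ 2) * besselK ν x) := by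
  rw [besselK_eq]
  refine ⟨_, hasDerivAt_besselKMoment ν 0 hx, ?_⟩
  have h := Real.sqrt_le_sqrt (sq_besselKMoment_le ν hx)
  rw [Real.sqrt_mul (by positivity), Real.sqrt_sq (besselKMoment_nonneg _ _ _),
    Real.sqrt_sq (mul_nonneg hx.le (besselKMoment_nonneg _ _ _))] at h
  rw [zero_add]
  linarith

lemma besselK_nonneg (ν x : ℝ) : 0 ≤ besselK ν x := by
  rw [besselK_eq]
  exact besselKMoment_nonneg ν 0 x

end BesselK

lemma antitoneOn_besselI_mul_besselK {ν : ℝ} (hν : -1 < ν) :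
    AntitoneOn (fun x => besselI ν x * besselK ν x) (Ioi 0) := by
  have hd : ∀ x, 0 < x → ∃ D ≤ 0, HasDerivAt (fun x => besselI ν x * besselK ν x) D x := by
    intro x hx
    obtain ⟨I', hI, hI'⟩ := exists_hasDerivAt_besselI hν hx
    obtain ⟨K', hK, hK'⟩ := exists_hasDerivAt_besselK ν hx
    refine ⟨_, ?_, hI.mul hK⟩
    have h1 := mul_le_mul_of_nonneg_right hI' (besselK_nonneg ν x)
    have h2 := mul_le_mul_of_nonneg_left hK' (besselI_nonneg hν hx)
    refine nonpos_of_mul_nonpos_right (a := x) ?_ hx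
    linarith
  refine antitoneOn_of_deriv_nonpos (convex_Ioi 0) (fun x hx => ?_) ?_ ?_
  · obtain ⟨D, -, h⟩ := hd x hx
    exact h.continuousAt.continuousWithinAt
  · rw [interior_Ioi]
    intro x hx
    obtain ⟨D, -, h⟩ := hd x hx
    exact h.differentiableAt.differentiableWithinAt
  · rw [interior_Ioi]
    intro x hx
    obtain ⟨D, hD, h⟩ := hd x hx
    rwa [h.deriv]

theorem stmt12 (ν : ℝ) (hν : -1 < ν) :
    AntitoneOn (fun x : ℝ => besselI ν x * besselK ν x / (1 + |Real.log x|)) (Ici 1) := by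
  intro x hx y hy hxy
  have hx1 : 1 ≤ x := hx
  have hx0 : 0 < x := by linarith
  have hy0 : 0 < y := by linarith
  have hlog := Real.log_le_log hx0 hxy
  have hlx := Real.log_nonneg hx1
  have hnum := antitoneOn_besselI_mul_besselK hν hx0 hy0 hxy
  have hnn := mul_nonneg (besselI_nonneg hν hx0) (besselK_nonneg ν x)
  simp only [abs_of_nonneg hlx, abs_of_nonneg (hlx.trans hlog)]
  gcongr
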